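/- arXiv:1810.06534 — 2 statements merged into one kernel-verified Lean document; each statement's English description precedes it below -/
import Mathlib

section
/- For every integer d ≥ 1 and every real number L > 0, the limit as ε → 0⁺ of the integral ∫_{[ε,L]^d} ε·(ε + t_1 + ⋯ + t_d)^{-(d+1)} dt_1⋯dt_d (Lebesgue integral over the cube [ε,L]^d ⊂ ℝ^d) exists and equals 1/(d+1)!. In particular, the value of this limit is independent of L. -/
open MeasureTheory

lemma continuousOn_inv_add_sum_pow (d n : ℕ) {a ε L : ℝ} (ha : 0 < a) (hε : 0 < ε) :
    ContinuousOn (fun t : Fin d → ℝ => ((a + ∑ i, t i) ^ n)⁻¹)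
      (Set.univ.pi fun _ : Fin d => Set.Icc ε L) := by
  refine ContinuousOn.inv₀ (by fun_prop) fun t ht => ?_
  have : 0 ≤ ∑ i, t i := Finset.sum_nonneg fun i _ => hε.le.trans (ht i trivial).1
  positivity

lemma integrableOn_inv_add_sum_pow (d n : ℕ) {a ε L : ℝ} (ha : 0 < a) (hε : 0 < ε) :
    IntegrableOn (fun t : Fin d → ℝ => ((a + ∑ i, t i) ^ n)⁻¹)
      (Set.univ.pi fun _ : Fin d => Set.Icc ε L) :=
  (continuousOn_inv_add_sum_pow d n ha hε).integrableOn_compact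
    (isCompact_univ_pi fun _ => isCompact_Icc)

lemma setIntegral_Icc_inv_add_pow (n : ℕ) {b ε L : ℝ} (hb : 0 < b) (hε : 0 < ε) (hL : ε ≤ L) :
    ∫ x in Set.Icc ε L, ((b + x) ^ (n + 2))⁻¹ =
      (n + 1 : ℝ)⁻¹ * (((b + ε) ^ (n + 1))⁻¹ - ((b + L) ^ (n + 1))⁻¹) := by
  rw [integral_Icc_eq_integral_Ioc, ← intervalIntegral.integral_of_le hL]
  have hpos : ∀ x ∈ Set.uIcc ε L, 0 < b + x := fun x hx => by
    rw [Set.uIcc_of_le hL] at hx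
    linarith [hx.1]
  rw [intervalIntegral.integral_eq_sub_of_hasDerivAt
    (f := fun x => -((n + 1 : ℝ)⁻¹ * ((b + x) ^ (n + 1))⁻¹))]
  · ring
  · intro x hx
    have h0 := (hpos x hx).ne'
    have h := (((((hasDerivAt_id x).const_add b).pow (n + 1)).inv
      (pow_ne_zero _ h0)).const_mul (n + 1 : ℝ)⁻¹).neg
    refine h.congr_deriv ?_
    simp only [id]
    push_cast
    have : (n + 1 : ℝ) ≠ 0 := by positivity
    simp only [Pi.pow_apply]
    field_simp
    ring_nf
  · refine ContinuousOn.intervalIntegrable (ContinuousOn.inv₀ (by fun_prop) fun x hx => ?_)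
    exact pow_ne_zero _ (hpos x hx).ne'

/-- Integrating out one coordinate. -/
lemma setIntegral_cube_succ (d : ℕ) {a ε L : ℝ} (ha : 0 < a) (hε : 0 < ε) (hL : ε ≤ L) :
    ∫ t in Set.univ.pi fun _ : Fin (d + 1) => Set.Icc ε L, ((a + ∑ i, t i) ^ (d + 2))⁻¹ =
      (d + 1 : ℝ)⁻¹ *
        ((∫ t in Set.univ.pi fun _ : Fin d => Set.Icc ε L,
            ((a + ε + ∑ i, t i) ^ (d + 1))⁻¹) -
          ∫ t in Set.univ.pi fun _ : Fin d => Set.Icc ε L,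
            ((a + L + ∑ i, t i) ^ (d + 1))⁻¹) := by
  have mp := (volume_preserving_piFinSuccAbove (fun _ : Fin (d + 1) => ℝ) 0).symm
  have hpre : (MeasurableEquiv.piFinSuccAbove (fun _ : Fin (d + 1) => ℝ) 0).symm ⁻¹'
      (Set.univ.pi fun _ : Fin (d + 1) => Set.Icc ε L) =
      Set.Icc ε L ×ˢ (Set.univ.pi fun _ : Fin d => Set.Icc ε L) := by
    ext ⟨x, y⟩
    simp only [Set.mem_preimage, Set.mem_pi, Set.mem_univ, true_implies, Fin.forall_fin_succ,
      Set.mem_prod]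
    rfl
  have hint := integrableOn_inv_add_sum_pow (d + 1) (d + 2) (L := L) ha hε
  rw [← mp.integrableOn_comp_preimage (MeasurableEquiv.measurableEmbedding _), hpre] at hint
  rw [← mp.setIntegral_preimage_emb (MeasurableEquiv.measurableEmbedding _), hpre]
  rw [IntegrableOn, Measure.volume_eq_prod, ← Measure.prod_restrict] at hint
  rw [Measure.volume_eq_prod, ← Measure.prod_restrict]
  refine (integral_prod_symm _ hint).trans ?_
  have hm : MeasurableSet (Set.univ.pi fun _ : Fin d => Set.Icc ε L) :=
    MeasurableSet.univ_pi fun _ => measurableSet_Icc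
  rw [← integral_sub (integrableOn_inv_add_sum_pow d _ (by linarith) hε)
    (integrableOn_inv_add_sum_pow d _ (by linarith) hε), ← integral_const_mul]
  refine setIntegral_congr_fun hm fun y hy => ?_
  have hs : 0 ≤ ∑ i, y i := Finset.sum_nonneg fun i _ => hε.le.trans (hy i trivial).1
  have h := setIntegral_Icc_inv_add_pow d (b := a + ∑ i, y i) (by positivity) hε hL
  simp only [add_right_comm a _ (∑ i, y i)]
  rw [← h]
  refine integral_congr_ae (Filter.Eventually.of_forall fun x => ?_)
  simp [MeasurableEquiv.piFinSuccAbove, Fin.sum_univ_succ, add_comm, add_left_comm]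

lemma tendsto_mul_setIntegral_cube (d : ℕ) {L : ℝ} (hL : 0 < L) {c M : ℝ} (hc : 0 < c)
    (hM : 0 ≤ M) :
    Filter.Tendsto
      (fun ε : ℝ => ε * ∫ t in Set.univ.pi fun _ : Fin d => Set.Icc ε L,
        ((c * ε + M + ∑ i, t i) ^ (d + 1))⁻¹)
      (nhdsWithin 0 (Set.Ioi 0))
      (nhds (if M = 0 then ((d.factorial : ℝ) * (c + d))⁻¹ else 0)) := by
  induction d generalizing c M with
  | zero =>
    have hvol (ε : ℝ) : (∫ t in Set.univ.pi fun _ : Fin 0 => Set.Icc ε L,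
        ((c * ε + M + ∑ i, t i) ^ (0 + 1))⁻¹) = (c * ε + M)⁻¹ := by
      rw [Set.eq_univ_of_forall fun t => Set.mem_univ_pi.2 fun i => i.elim0]
      rw [Measure.restrict_univ, volume_pi, Measure.pi_of_empty _ 0, integral_dirac]
      simp
    simp only [hvol]
    split_ifs with h
    · refine tendsto_const_nhds.congr' ?_
      filter_upwards [self_mem_nhdsWithin] with ε (hε : 0 < ε)
      simp [h]
      field_simp
    · refine Filter.Tendsto.mono_left ?_ nhdsWithin_le_nhds
      have : ContinuousAt (fun ε : ℝ => ε * (c * ε + M)⁻¹) 0 := by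
        refine continuousAt_id.mul (ContinuousAt.inv₀ (by fun_prop) (by simpa using h))
      simpa [ContinuousAt] using this
  | succ d ih =>
    have h1 := ih (c := c + 1) (by positivity) hM
    have h2 := ih hc (add_nonneg hM hL.le)
    rw [if_neg (by positivity)] at h2
    have h := (h1.sub h2).const_mul (d + 1 : ℝ)⁻¹
    refine (h.congr' ?_).trans_eq ?_
    · filter_upwards [Ioo_mem_nhdsGT hL] with ε hε
      have hε0 := hε.1
      rw [setIntegral_cube_succ d (by positivity) hε.1 hε.2.le,
        show (c + 1) * ε + M = c * ε + M + ε by ring, ← add_assoc (c * ε) M L]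
      ring
    · split_ifs
      · rw [Nat.factorial_succ]
        push_cast
        rw [sub_zero, ← mul_inv]
        ring_nf
      · simp

/-- For every integer `d ≥ 1` and every real `L > 0`, the limit as `ε → 0⁺` of the integral
`∫_{[ε,L]^d} ε (ε + t₁ + ⋯ + t_d)^{-(d+1)} dt` exists and equals `1/(d+1)!`
(in particular it is independent of `L`). -/
theorem charge_anomaly_weight (d : ℕ) (hd : 1 ≤ d) (L : ℝ) (hL : 0 < L) :
    Filter.Tendsto
      (fun ε : ℝ =>
        ∫ t : Fin d → ℝ in Set.univ.pi fun _ : Fin d => Set.Icc ε L,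
          ε / (ε + ∑ i, t i) ^ (d + 1))
      (nhdsWithin 0 (Set.Ioi 0))
      (nhds (1 / (Nat.factorial (d + 1) : ℝ))) := by
  have h := tendsto_mul_setIntegral_cube d hL one_pos le_rfl
  simp only [if_true, one_mul, add_zero, ← integral_const_mul, ← div_eq_mul_inv] at h
  rwa [Nat.factorial_succ, one_div, Nat.cast_mul, Nat.cast_succ, mul_comm, add_comm (d : ℝ)]
end

section
/- Let d ≥ 2 and R = ℂ[z_1,…,z_d], and let (C^•, δ) be the alternating Čech complex of the cover of 𝔸^d ∖ {0} by the principal opens D(z_i): C^p = ⨁_{1 ≤ i_0 < ⋯ < i_p ≤ d} R[(z_{i_0}⋯z_{i_p})^{−1}] for 0 ≤ p ≤ d−1, with differential (δω)_{i_0 < ⋯ < i_{p+1}} = Σ_{q=0}^{p+1} (−1)^q ω_{i_0 < ⋯ < î_q < ⋯ < i_{p+1}} (images under the canonical localization maps, all inside ℂ(z_1,…,z_d)). Then for every p with 0 < p < d−1, the complex is exact in degree p: ker(δ : C^p → C^{p+1}) = im(δ : C^{p−1} → C^p). That is, H^p(𝔸^d ∖ {0}, 𝒪_alg) = 0 for 0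 < p < d−1. -/
noncomputable section

/-- The ambient Laurent polynomial module `ℂ[z₁^{±1},…,z_d^{±1}]` with monomial basis
`z^α`, `α ∈ ℤ^d`; it contains all the localizations `R_S` below. -/
abbrev LaurentMod (d : ℕ) := (Fin d → ℤ) →₀ ℂ

/-- The localization `R_S = ℂ[z₁,…,z_d][(∏_{i∈S} zᵢ)⁻¹]`: the span of the monomials `z^α`
with `αᵢ ≥ 0` for all `i ∉ S`. -/
def locS (d : ℕ) (S : Finset (Fin d)) : Submodule ℂ (LaurentMod d) :=
  Finsupp.supported ℂ ℂ {α : Fin d → ℤ | ∀ i ∉ S, 0 ≤ α i}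

/-- The canonical localization maps: `R_S ⊆ R_T` for `S ⊆ T`. -/
theorem locS_mono (d : ℕ) {S T : Finset (Fin d)} (h : S ⊆ T) : locS d S ≤ locS d T :=
  Finsupp.supported_mono fun _ hα i hi => hα i fun hiS => hi (h hiS)

/-- The alternating Čech `p`-cochains for the cover of `𝔸^d ∖ {0}` by the `D(zᵢ)`:
`C^p = ⨁_{i₀ < ⋯ < i_p} R_{{i₀,…,i_p}}`. -/
abbrev CechCochain (d p : ℕ) :=
  ∀ S : {S : Finset (Fin d) // S.card = p + 1}, locS d S.1

/-- The alternating Čech differential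
`(δω)_{i₀<⋯<i_{p+1}} = ∑_q (-1)^q ω_{i₀<⋯<î_q<⋯<i_{p+1}}`, where the summand for the
omitted index `t` carries the sign `(-1)^{#{s ∈ T | s < t}}` and is included along the
canonical localization map. -/
def cechDiff (d p : ℕ) : CechCochain d p →ₗ[ℂ] CechCochain d (p + 1) where
  toFun ω T :=
    ∑ t ∈ T.1.attach,
      ((-1 : ℂ) ^ (T.1.filter (fun s => s < t.1)).card) •
        Submodule.inclusion (locS_mono d (Finset.erase_subset t.1 T.1))
          (ω ⟨T.1.erase t.1, by
            simp [Finset.card_erase_of_mem t.2, T.2]⟩)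
  map_add' ω ω' := by
    funext T
    simp [Finset.sum_add_distrib, smul_add]
  map_smul' c ω := by
    funext T
    simp only [Pi.smul_apply, map_smul, RingHom.id_apply, Finset.smul_sum]
    exact Finset.sum_congr rfl fun t _ => smul_comm _ _ _

/-- The sign `(-1)^{#{s ∈ T | s < t}}` of the face of `T` omitting `t`. -/
def faceSign {ι : Type*} [LinearOrder ι] (T : Finset ι) (t : ι) : ℂ :=
  (-1 : ℂ) ^ (T.filter (fun s => s < t)).card

theorem faceSign_mul_self {ι : Type*} [LinearOrder ι] (T : Finset ι) (t : ι) :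
    faceSign T t * faceSign T t = 1 := by
  rw [faceSign, ← mul_pow]; simp

theorem faceSign_insert {ι : Type*} [LinearOrder ι] {S : Finset ι} {j : ι} (hj : j ∉ S) (t : ι) :
    faceSign (insert j S) t = (if j < t then -1 else 1) * faceSign S t := by
  unfold faceSign
  rw [Finset.filter_insert]
  split_ifs with h
  · rw [Finset.card_insert_of_notMem (by simp [hj]), pow_succ, mul_comm]
  · simp

theorem faceSign_eq_mul_erase {ι : Type*} [LinearOrder ι] {S : Finset ι} {u : ι} (hu : u ∈ S)
    (t : ι) : faceSign S t = (if u < t then -1 else 1) * faceSign (S.erase u) t := by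
  rw [← faceSign_insert (Finset.notMem_erase u S), Finset.insert_erase hu]

/-- The alternating simplicial differential on functions of finite sets. -/
def simplexDiff {ι : Type*} [LinearOrder ι] (f : Finset ι → ℂ) (T : Finset ι) : ℂ :=
  ∑ t ∈ T, faceSign T t * f (T.erase t)

theorem simplexDiff_simplexDiff {ι : Type*} [LinearOrder ι] (f : Finset ι → ℂ) (T : Finset ι) :
    simplexDiff (simplexDiff f) T = 0 := by
  have key : simplexDiff (simplexDiff f) T = ∑ t ∈ T, ∑ u ∈ T, if u = t then 0 else
      faceSign T t * (faceSign (T.erase t) u * f ((T.erase t).erase u)) := by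
    refine Finset.sum_congr rfl fun t ht => ?_
    rw [simplexDiff, Finset.mul_sum, ← Finset.add_sum_erase T _ ht, if_pos rfl, zero_add]
    exact Finset.sum_congr rfl fun u hu => by rw [if_neg (Finset.ne_of_mem_erase hu)]
  have anti : simplexDiff (simplexDiff f) T = -simplexDiff (simplexDiff f) T := by
    conv_lhs => rw [key, Finset.sum_comm]
    rw [key, ← Finset.sum_neg_distrib]
    refine Finset.sum_congr rfl fun t ht => ?_
    rw [← Finset.sum_neg_distrib]
    refine Finset.sum_congr rfl fun u hu => ?_
    rcases lt_trichotomy t u with h | h | h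
    · rw [if_neg h.ne, if_neg h.ne', Finset.erase_right_comm, faceSign_eq_mul_erase ht u,
        faceSign_eq_mul_erase hu t, if_pos h, if_neg h.not_gt]
      ring
    · simp [h]
    · rw [if_neg h.ne', if_neg h.ne, Finset.erase_right_comm, faceSign_eq_mul_erase ht u,
        faceSign_eq_mul_erase hu t, if_pos h, if_neg h.not_gt]
      ring
  exact self_eq_neg.mp anti

/-- Contraction of a simplicial cochain against the vertex `j`. -/
def simplexContract {ι : Type*} [LinearOrder ι] (j : ι) (f : Finset ι → ℂ) (S : Finset ι) : ℂ :=
  if j ∈ S then 0 else faceSign S j * f (insert j S)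

theorem simplexDiff_simplexContract {ι : Type*} [LinearOrder ι] (j : ι) (f : Finset ι → ℂ)
    (S : Finset ι) (hf : j ∉ S → simplexDiff f (insert j S) = 0) :
    simplexDiff (simplexContract j f) S = f S := by
  by_cases hj : j ∈ S
  · rw [simplexDiff, Finset.sum_eq_single_of_mem j hj]
    · rw [simplexContract, if_neg (Finset.notMem_erase j S), Finset.insert_erase hj,
        faceSign_eq_mul_erase hj j, if_neg (lt_irrefl j), one_mul, ← mul_assoc,
        faceSign_mul_self, one_mul]
    · intro t _ ht
      rw [simplexContract, if_pos (Finset.mem_erase.mpr ⟨ht.symm, hj⟩), mul_zero]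
  · have h := hf hj
    rw [simplexDiff, Finset.sum_insert hj, Finset.erase_insert hj, faceSign_insert hj,
      if_neg (lt_irrefl j), one_mul] at h
    have hsum : simplexDiff (simplexContract j f) S = -(faceSign S j *
        ∑ t ∈ S, faceSign (insert j S) t * f ((insert j S).erase t)) := by
      rw [simplexDiff, Finset.mul_sum, ← Finset.sum_neg_distrib]
      refine Finset.sum_congr rfl fun t ht => ?_
      have htj : j ≠ t := fun e => hj (e ▸ ht)
      rw [simplexContract, if_neg fun h => hj (Finset.mem_of_mem_erase h),
        Finset.erase_insert_of_ne htj, faceSign_insert hj, faceSign_eq_mul_erase ht j]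
      rcases lt_or_gt_of_ne htj with h | h
      · rw [if_pos h, if_neg h.not_gt]; ring
      · rw [if_pos h, if_neg h.not_gt]; ring
    rw [hsum]
    linear_combination f S * faceSign_mul_self S j - faceSign S j * h

/-- The coefficients at `z^α` of a Čech cochain, extended by zero to all finite sets. -/
def cechCoeff {d p : ℕ} (ω : CechCochain d p) (α : Fin d → ℤ) (S : Finset (Fin d)) : ℂ :=
  if h : S.card = p + 1 then (ω ⟨S, h⟩ : LaurentMod d) α else 0

theorem cechCoeff_of_card {d p : ℕ} (ω : CechCochain d p) (α : Fin d → ℤ) {S : Finset (Fin d)}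
    (h : S.card = p + 1) : cechCoeff ω α S = (ω ⟨S, h⟩ : LaurentMod d) α :=
  dif_pos h

theorem CechCochain.ext_cechCoeff {d p : ℕ} {ω ω' : CechCochain d p}
    (h : ∀ α S, S.card = p + 1 → cechCoeff ω α S = cechCoeff ω' α S) : ω = ω' := by
  funext S
  refine Subtype.ext (Finsupp.ext fun α => ?_)
  simpa only [cechCoeff_of_card _ _ S.2] using h α S.1 S.2

theorem nonneg_of_cechCoeff_ne_zero {d p : ℕ} {ω : CechCochain d p} {α : Fin d → ℤ}
    {S : Finset (Fin d)} (h : cechCoeff ω α S ≠ 0) : ∀ i ∉ S, 0 ≤ α i := by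
  unfold cechCoeff at h
  split_ifs at h with hS
  · exact (Finsupp.mem_supported ℂ _).mp (ω ⟨S, hS⟩).2 (Finsupp.mem_support_iff.mpr h)
  · exact absurd rfl h

theorem cechCoeff_cechDiff {d p : ℕ} (ω : CechCochain d p) (α : Fin d → ℤ) {T : Finset (Fin d)}
    (hT : T.card = p + 2) :
    cechCoeff (cechDiff d p ω) α T = simplexDiff (cechCoeff ω α) T := by
  rw [cechCoeff_of_card _ _ hT, simplexDiff, ← Finset.sum_attach T]
  simp only [cechDiff, LinearMap.coe_mk, AddHom.coe_mk, Submodule.coe_sum, Submodule.coe_smul,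
    Submodule.coe_inclusion, Finsupp.coe_finsetSum, Finset.sum_apply, Finsupp.smul_apply,
    smul_eq_mul]
  refine Finset.sum_congr rfl fun t _ => ?_
  rw [cechCoeff_of_card _ _ (by simp [Finset.card_erase_of_mem t.2, hT]), faceSign]

theorem cechDiff_cechDiff {d p : ℕ} (ω : CechCochain d p) :
    cechDiff d (p + 1) (cechDiff d p ω) = 0 := by
  refine CechCochain.ext_cechCoeff fun α S hS => ?_
  rw [cechCoeff_cechDiff _ _ hS, cechCoeff_of_card _ _ hS]
  refine Eq.trans ?_ (simplexDiff_simplexDiff (cechCoeff ω α) S)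
  refine Finset.sum_congr rfl fun t ht => ?_
  rw [cechCoeff_cechDiff _ _ (by simp [Finset.card_erase_of_mem ht, hS])]

open Classical in
/-- The contraction of a Čech cochain which in multidegree `α` contracts against the vertex
`c α` (and is zero where there is none), provided `c` only selects vertices `j` with `0 ≤ α j`. -/
def cechContract {d p : ℕ} (c : (Fin d → ℤ) → Option (Fin d))
    (hc : ∀ α j, c α = some j → 0 ≤ α j) (ω : CechCochain d (p + 1)) : CechCochain d p :=
  fun S => ⟨∑ j ∈ S.1ᶜ.attach, faceSign S.1 j.1 •
      ((ω ⟨insert j.1 S.1, by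
        rw [Finset.card_insert_of_notMem (Finset.mem_compl.mp j.2), S.2]⟩ :
          LaurentMod d).filter fun α => c α = some j.1), by
    refine Submodule.sum_mem _ fun j _ => Submodule.smul_mem _ _ ?_
    refine (Finsupp.mem_supported ℂ _).mpr fun α hα i hi => ?_
    rw [Finset.mem_coe, Finsupp.support_filter, Finset.mem_filter] at hα
    by_cases hij : i = j.1
    · exact hij ▸ hc α j.1 hα.2
    · exact (Finsupp.mem_supported ℂ _).mp (ω _).2 hα.1 i (by simp [hij, hi])⟩

theorem cechCoeff_cechContract {d p : ℕ} (c : (Fin d → ℤ) → Option (Fin d))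
    (hc : ∀ α j, c α = some j → 0 ≤ α j) (ω : CechCochain d (p + 1)) (α : Fin d → ℤ)
    {S : Finset (Fin d)} (hS : S.card = p + 1) :
    cechCoeff (cechContract c hc ω) α S =
      (c α).elim 0 fun j => simplexContract j (cechCoeff ω α) S := by
  classical
  have hsum : cechCoeff (cechContract c hc ω) α S =
      ∑ j ∈ Sᶜ, if c α = some j then faceSign S j * cechCoeff ω α (insert j S) else 0 := by
    rw [cechCoeff_of_card _ _ hS, ← Finset.sum_attach Sᶜ]
    simp only [cechContract, Finsupp.coe_finsetSum, Finset.sum_apply, Finsupp.smul_apply,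
      smul_eq_mul, Finsupp.filter_apply, mul_ite, mul_zero]
    refine Finset.sum_congr rfl fun j _ => ?_
    rw [cechCoeff_of_card _ _
      (by rw [Finset.card_insert_of_notMem (Finset.mem_compl.mp j.2), hS])]
  rw [hsum]
  cases c α with
  | none => simp
  | some j => by_cases hj : j ∈ S <;> simp [simplexContract, hj]

theorem exists_partial_nonneg_index (d : ℕ) : ∃ c : (Fin d → ℤ) → Option (Fin d),
    (∀ α j, c α = some j → 0 ≤ α j) ∧ ∀ α, c α = none → ∀ j, α j < 0 := by
  classical
  refine ⟨fun α => if h : ∃ j, 0 ≤ α j then some h.choose else none, fun α j h => ?_,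
    fun α h => ?_⟩
  · dsimp only at h
    split_ifs at h with hα
    exact Option.some.inj h ▸ hα.choose_spec
  · simpa using h

/-- Exactness of the Čech complex in intermediate degrees:
`H^p(𝔸^d ∖ {0}, 𝒪) = 0` for `0 < p < d - 1` (here the middle degree is `p + 1` with
`0 < p + 1 < d - 1`). -/
theorem middle_cohomology_punctured_affine_vanishes (d p : ℕ) (hd : 2 ≤ d)
    (hp : p + 1 < d - 1) :
    LinearMap.ker (cechDiff d (p + 1)) = LinearMap.range (cechDiff d p) := by
  refine le_antisymm (fun ω hω => ?_) ?_
  · obtain ⟨c, hc, hc'⟩ := exists_partial_nonneg_index d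
    refine ⟨cechContract c hc ω, CechCochain.ext_cechCoeff fun α S hS => ?_⟩
    have hcoeff : simplexDiff (cechCoeff (cechContract c hc ω) α) S =
        simplexDiff (fun S => (c α).elim 0 fun j => simplexContract j (cechCoeff ω α) S) S :=
      Finset.sum_congr rfl fun t ht => by
        rw [cechCoeff_cechContract c hc ω α (by simp [Finset.card_erase_of_mem ht, hS])]
    rw [cechCoeff_cechDiff _ _ hS, hcoeff]
    cases hα : c α with
    | none =>
      obtain ⟨i, hi⟩ : ∃ i, i ∉ S := by
        by_contra! h
        have := Finset.card_le_card (fun i _ => h i : Finset.univ ⊆ S)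
        rw [Finset.card_fin] at this
        omega
      have hzero : cechCoeff ω α S = 0 := by
        by_contra h
        exact (hc' α hα i).not_ge (nonneg_of_cechCoeff_ne_zero h i hi)
      simp [simplexDiff, hzero]
    | some j =>
      refine simplexDiff_simplexContract j _ S fun hj => ?_
      have hcard : (insert j S).card = p + 1 + 2 := by
        rw [Finset.card_insert_of_notMem hj, hS]
      rw [← cechCoeff_cechDiff ω α hcard, LinearMap.mem_ker.mp hω, cechCoeff_of_card _ _ hcard]
      rfl
  · rintro _ ⟨ω, rfl⟩
    exact cechDiff_cechDiff ω

end
end
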